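/- arXiv:2104.07232 — 2 statements merged into one kernel-verified Lean document; each statement's English description precedes it below -/
import Mathlib

section
/- Let μ_j = N(m_j, C_j) for j = 1,…,k be Gaussian measures on ℝ^d with positive definite covariances, and let w_1,…,w_k > 0 with Σ_j w_j = 1. Then the map Ψ(C) := Σ_{j=1}^k w_j (C^{1/2} C_j C^{1/2})^{1/2} on symmetric positive definite matrices has a unique positive definite fixed point C*, and the Gaussian measure N(Σ_{j=1}^k w_j m_j, C*) minimizes the barycenter objective B(ν) := Σ_{j=1}^k w_j L(ν, μ_j) over all probability measures ν on ℝ^d with finite second moment. -/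
open MeasureTheory Matrix
open scoped RealInnerProductSpace

/-- The Gaussian probability measure `N(m, C)` on `ℝ^d` (for `C` positive definite), given
by its density `(2π)^{-d/2} det C^{-1/2} exp(-½ ⟪x-m, C⁻¹ (x-m)⟫)` w.r.t. Lebesgue. -/
noncomputable def gaussianMeasure (d : ℕ) (m : EuclideanSpace ℝ (Fin d))
    (C : Matrix (Fin d) (Fin d) ℝ) : Measure (EuclideanSpace ℝ (Fin d)) :=
  volume.withDensity fun x =>
    ENNReal.ofReal (Real.sqrt (((2 * Real.pi) ^ d * C.det)⁻¹) *
      Real.exp (-(1 / 2 : ℝ) * ⟪x - m, (C⁻¹).toEuclideanLin (x - m)⟫))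

/-- The Kantorovich cost `L(α,β)` for the quadratic cost on `ℝ^d`: the infimum of
`∫ ‖x - y‖² dπ` over all couplings `π` of `α` and `β`. -/
noncomputable def kantorovich (d : ℕ) (α β : Measure (EuclideanSpace ℝ (Fin d))) : ℝ :=
  sInf {c : ℝ | ∃ π : Measure (EuclideanSpace ℝ (Fin d) × EuclideanSpace ℝ (Fin d)),
    IsProbabilityMeasure π ∧ π.map Prod.fst = α ∧ π.map Prod.snd = β ∧
    c = ∫ p, ‖p.1 - p.2‖ ^ 2 ∂π}

/-- `S` is the (unique) positive semidefinite square root of `M`. -/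
def IsSqrtOf {d : ℕ} (S M : Matrix (Fin d) (Fin d) ℝ) : Prop :=
  S.PosSemidef ∧ S * S = M

/-- `Cs` is a fixed point of the map `Ψ(C) = ∑ j, w j • (C^{1/2} * Cov j * C^{1/2})^{1/2}`
(square roots taken in the positive semidefinite sense). -/
def IsGaussianBarycenterFixedPoint {d k : ℕ} (w : Fin k → ℝ)
    (Cov : Fin k → Matrix (Fin d) (Fin d) ℝ) (Cs : Matrix (Fin d) (Fin d) ℝ) : Prop :=
  ∃ R : Matrix (Fin d) (Fin d) ℝ, IsSqrtOf R Cs ∧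
    ∃ N : Fin k → Matrix (Fin d) (Fin d) ℝ,
      (∀ j, IsSqrtOf (N j) (R * Cov j * R)) ∧ Cs = ∑ j, w j • N j

namespace Matrix

section
variable {n : Type*} [Fintype n]

lemma trace_mul_vecMulVec (M : Matrix n n ℝ) (u v : n → ℝ) :
    (M * vecMulVec u v).trace = v ⬝ᵥ M *ᵥ u := by
  rw [mul_vecMulVec, trace_vecMulVec, dotProduct_comm]

lemma isCompact_setOf_mul_transpose_eq (C : Matrix n n ℝ) :
    IsCompact {A : Matrix n n ℝ | A * Aᵀ = C} := by
  have hK : IsCompact (X := Matrix n n ℝ) _ := isCompact_univ_pi fun i : n =>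
    isCompact_univ_pi fun _ : n => isCompact_Icc (a := -(C i i + 1)) (b := C i i + 1)
  refine hK.of_isClosed_subset (isClosed_eq (by fun_prop) continuous_const) ?_
  rintro A rfl i - j -
  have h1 : (A i j) ^ 2 ≤ (A * Aᵀ) i i := by
    rw [mul_apply]
    simp only [transpose_apply, ← sq]
    exact Finset.single_le_sum (f := fun j => A i j ^ 2) (fun _ _ => sq_nonneg _)
      (Finset.mem_univ j)
  constructor <;> nlinarith [sq_nonneg (A i j - 1), sq_nonneg (A i j + 1)]

variable [DecidableEq n]

/-- The reflection `1 - (2 / ⟨u, u⟩) u uᵀ` along the vector `u`. -/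
noncomputable def householder (u : n → ℝ) : Matrix n n ℝ :=
  1 - (2 / (u ⬝ᵥ u)) • vecMulVec u u

lemma householder_transpose (u : n → ℝ) : (householder u)ᵀ = householder u := by
  simp [householder, transpose_vecMulVec]

lemma householder_mul_self {u : n → ℝ} (hu : u ⬝ᵥ u ≠ 0) :
    householder u * householder u = 1 := by
  simp only [householder, sub_mul, mul_sub, one_mul, mul_one, smul_mul_assoc, mul_smul_comm,
    vecMulVec_mul_vecMulVec]
  have : 2 / (u ⬝ᵥ u) * (2 / (u ⬝ᵥ u)) * (u ⬝ᵥ u) = 2 / (u ⬝ᵥ u) + 2 / (u ⬝ᵥ u) := by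
    field_simp; norm_num
  rw [vecMulVec_smul, smul_sub, smul_smul, smul_smul, this, add_smul]
  abel

lemma trace_mul_householder (M : Matrix n n ℝ) (u : n → ℝ) :
    (M * householder u).trace = M.trace - 2 / (u ⬝ᵥ u) * (u ⬝ᵥ M *ᵥ u) := by
  simp [householder, mul_sub, trace_mul_vecMulVec]

lemma trace_mul_householder_mul_householder (M : Matrix n n ℝ) (u v : n → ℝ) :
    (M * (householder u * householder v)).trace =
      M.trace - 2 / (u ⬝ᵥ u) * (u ⬝ᵥ M *ᵥ u) - 2 / (v ⬝ᵥ v) * (v ⬝ᵥ M *ᵥ v) +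
        2 / (u ⬝ᵥ u) * (2 / (v ⬝ᵥ v)) * (u ⬝ᵥ v) * (v ⬝ᵥ M *ᵥ u) := by
  simp only [householder, mul_sub, sub_mul, one_mul, mul_one, mul_smul_comm, smul_mul_assoc,
    vecMulVec_mul_vecMulVec, trace_sub, trace_smul, trace_mul_vecMulVec, smul_eq_mul,
    vecMulVec_smul, smul_smul]
  ring

/-- A real square matrix `M` for which the identity maximizes `O ↦ tr (M O)` over orthogonal
matrices is symmetric positive semidefinite. -/
lemma posSemidef_of_trace_mul_orthogonal_le {M : Matrix n n ℝ}
    (h : ∀ O : Matrix n n ℝ, O * Oᵀ = 1 → (M * O).trace ≤ M.trace) : M.PosSemidef := by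
  have hself : ∀ u : n → ℝ, u ≠ 0 → 0 < u ⬝ᵥ u := fun u hu => by
    simpa using dotProduct_star_self_pos_iff.2 hu
  refine .of_dotProduct_mulVec_nonneg ?_ fun u => ?_
  · ext i j
    rcases eq_or_ne i j with rfl | hij
    · simp
    set a := M i i + M j j with ha
    have ha0 : 0 ≤ a := by
      have hdiag : ∀ l, 0 ≤ M l l := fun l => by
        have h1 := h (householder (Pi.single l 1)) (by
          rw [householder_transpose, householder_mul_self (by simp)])
        rw [trace_mul_householder] at h1
        simpa using h1
      exact add_nonneg (hdiag i) (hdiag j)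
    have key : ∀ t : ℝ, t * (M j i - M i j) ≤ t ^ 2 * a := fun t => by
      set u : n → ℝ := Pi.single i 1 with hu
      set v : n → ℝ := Pi.single i 1 + t • Pi.single j 1 with hv
      have huu : u ⬝ᵥ u = 1 := by simp [hu]
      have hvv : v ⬝ᵥ v = 1 + t ^ 2 := by
        simp [hv, dotProduct_add, hij, hij.symm]; ring
      have huv : u ⬝ᵥ v = 1 := by simp [hu, hv, dotProduct_add, hij.symm]
      have hvM : v ⬝ᵥ M *ᵥ u = M i i + t * M j i := by
        simp [hu, hv, add_dotProduct]
      have huM : u ⬝ᵥ M *ᵥ u = M i i := by simp [hu]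
      have hvMv : v ⬝ᵥ M *ᵥ v = M i i + t * M i j + t * M j i + t ^ 2 * M j j := by
        simp [hv, add_dotProduct, mulVec_add, mulVec_smul]; ring
      have h1 := h (householder u * householder v) (by
        rw [transpose_mul, householder_transpose, householder_transpose, Matrix.mul_assoc,
          ← Matrix.mul_assoc (householder v), householder_mul_self (by rw [hvv]; positivity),
          Matrix.one_mul, householder_mul_self (by simp [huu])])
      rw [trace_mul_householder_mul_householder, huu, hvv, huv, hvM, huM, hvMv] at h1
      have hpos : 0 < 1 + t ^ 2 := by positivity
      have h2 : (1 + t ^ 2) * (2 / (1 + t ^ 2)) = 2 := by field_simp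
      have h3 := mul_le_mul_of_nonneg_left h1 hpos.le
      generalize 2 / (1 + t ^ 2) = c at h2 h3
      linear_combination (1 / 2 : ℝ) * h3 - (1 / 2 : ℝ) *
        (-(M i i + t * M i j + t * M j i + t ^ 2 * M j j) + 2 * (M i i + t * M j i)) * h2
    have h1 := key ((M j i - M i j) / (a + 1))
    have h2 : M j i - M i j = 0 := by
      have hpos : 0 < a + 1 := by positivity
      set δ := M j i - M i j
      have h3 := mul_le_mul_of_nonneg_left h1 (sq_nonneg (a + 1))
      have h4 : (a + 1) ^ 2 * (δ / (a + 1) * δ) = (a + 1) * δ ^ 2 := by field_simp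
      have h5 : (a + 1) ^ 2 * ((δ / (a + 1)) ^ 2 * a) = a * δ ^ 2 := by field_simp
      rw [h4, h5] at h3
      nlinarith [sq_nonneg δ]
    simp only [conjTranspose_apply, star_trivial]
    linarith
  · rcases eq_or_ne u 0 with rfl | hu
    · simp
    have h1 := h (householder u) (by
      rw [householder_transpose, householder_mul_self (hself u hu).ne'])
    rw [trace_mul_householder] at h1
    have h2 : 0 ≤ 2 / (u ⬝ᵥ u) * (u ⬝ᵥ M *ᵥ u) := by linarith
    have h3 : 0 < 2 / (u ⬝ᵥ u) := div_pos two_pos (hself u hu)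
    simpa using nonneg_of_mul_nonneg_right h2 h3

lemma PosSemidef.exists_mul_self_eq {C : Matrix n n ℝ} (hC : C.PosSemidef) :
    ∃ R : Matrix n n ℝ, R.PosSemidef ∧ R * R = C := by
  open scoped MatrixOrder in
  exact ⟨CFC.sqrt C, nonneg_iff_posSemidef.1 (CFC.sqrt_nonneg C),
    CFC.sqrt_mul_sqrt_self C hC.nonneg⟩

end

section
variable {n ι : Type*} [Fintype n] [DecidableEq n] [Fintype ι]

/-- For positive definite matrices `C j` and positive weights `w j` there is a positive definite
matrix `S` together with positive definite matrices `T j` transporting `S` to `C j` whose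
weighted mean is the identity. -/
lemma exists_posDef_transport_family [DecidableEq ι] [Nonempty ι] {C : ι → Matrix n n ℝ}
    (hC : ∀ j, (C j).PosDef)
    {w : ι → ℝ} (hw : ∀ j, 0 < w j) :
    ∃ (S : Matrix n n ℝ) (T : ι → Matrix n n ℝ), S.PosDef ∧ (∀ j, (T j).PosDef) ∧
      (∀ j, T j * S * T j = C j) ∧ ∑ j, w j • T j = 1 := by
  have hcpt : IsCompact (Set.univ.pi fun j => {A : Matrix n n ℝ | A * Aᵀ = C j}) :=
    isCompact_univ_pi fun j => isCompact_setOf_mul_transpose_eq (C j)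
  have hne : (Set.univ.pi fun j => {A : Matrix n n ℝ | A * Aᵀ = C j}).Nonempty := by
    choose R hR hRC using fun j => (hC j).posSemidef.exists_mul_self_eq
    refine ⟨R, fun j _ => ?_⟩
    have : (R j)ᵀ = R j := (hR j).isHermitian
    simp [this, hRC]
  let F : (ι → Matrix n n ℝ) → ℝ := fun A => ((∑ j, w j • A j)ᵀ * ∑ j, w j • A j).trace
  have hF : Continuous F := by fun_prop
  obtain ⟨A, hA, hmax⟩ := hcpt.exists_isMaxOn hne hF.continuousOn
  replace hA : ∀ j, A j * (A j)ᵀ = C j := fun j => hA j (Set.mem_univ j)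
  set B := ∑ j, w j • A j with hB
  have hAu : ∀ j, IsUnit (A j) := fun j => by
    rw [isUnit_iff_isUnit_det]
    have h1 := (isUnit_iff_isUnit_det _).1 (hC j).isUnit
    rw [← hA j, det_mul] at h1
    exact isUnit_of_mul_isUnit_left h1
  have hpsd : ∀ j, (Bᵀ * A j - w j • ((A j)ᵀ * A j)).PosSemidef := fun j => by
    refine posSemidef_of_trace_mul_orthogonal_le fun O hO => ?_
    have hmem : Function.update A j (A j * O) ∈
        Set.univ.pi fun j => {A : Matrix n n ℝ | A * Aᵀ = C j} := by
      intro i _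
      rcases eq_or_ne i j with rfl | hij
      · simp only [Function.update_self, Set.mem_ofPred_eq, transpose_mul]
        rw [Matrix.mul_assoc, ← Matrix.mul_assoc O, hO, Matrix.one_mul, hA]
      · simp [hij, hA]
    have hB' : ∑ i, w i • Function.update A j (A j * O) i = B + w j • (A j * (O - 1)) := by
      rw [hB, ← sub_eq_iff_eq_add', ← Finset.sum_sub_distrib, Finset.sum_eq_single j]
      · simp [mul_sub, smul_sub]
      · intro i _ hij
        simp [hij]
      · simp
    have hle : F (Function.update A j (A j * O)) ≤ F A := hmax hmem
    simp only [F, hB', ← hB] at hle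
    set G := (A j)ᵀ * A j with hG
    have hGt : Gᵀ = G := by simp [hG]
    have hOO : Oᵀ * O = 1 := mul_eq_one_comm.1 hO
    have e1 : ((B + w j • (A j * (O - 1)))ᵀ * (B + w j • (A j * (O - 1)))).trace =
        (Bᵀ * B).trace + 2 * w j * (Bᵀ * A j * (O - 1)).trace +
          w j ^ 2 * ((O - 1)ᵀ * G * (O - 1)).trace := by
      have : ((A j * (O - 1))ᵀ * B).trace = (Bᵀ * A j * (O - 1)).trace := by
        rw [← trace_transpose]
        simp [Matrix.mul_assoc]
      simp only [transpose_add, transpose_smul, add_mul, mul_add, smul_mul_assoc, mul_smul_comm,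
        trace_add, trace_smul, this, smul_eq_mul, hG]
      simp only [transpose_mul, Matrix.mul_assoc]
      ring
    have e2 : ((O - 1)ᵀ * G * (O - 1)).trace = -2 * (G * (O - 1)).trace := by
      have h1 : (Oᵀ * G * O).trace = G.trace := by
        rw [trace_mul_cycle, hO, Matrix.one_mul]
      have h2 : (Oᵀ * G).trace = (G * O).trace := by
        rw [← trace_transpose]; simp [hGt]
      simp only [transpose_sub, transpose_one, sub_mul, mul_sub, Matrix.one_mul, Matrix.mul_one,
        trace_sub, h1, h2]
      ring
    rw [e1, e2] at hle
    have h3 : w j * ((Bᵀ * A j * (O - 1)).trace - w j * (G * (O - 1)).trace) ≤ 0 := by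
      nlinarith
    have h4 := nonpos_of_mul_nonpos_right h3 (hw j)
    have h5 : ((Bᵀ * A j - w j • G) * O).trace - (Bᵀ * A j - w j • G).trace =
        (Bᵀ * A j * (O - 1)).trace - w j * (G * (O - 1)).trace := by
      simp only [sub_mul, mul_sub, Matrix.mul_one, trace_sub, smul_mul_assoc, trace_smul,
        smul_eq_mul]
      ring
    linarith
  have hpd : ∀ j, (Bᵀ * A j).PosDef := fun j => by
    have h1 : ((A j)ᵀ * A j).PosDef := by
      simpa using PosDef.conjTranspose_mul_self (A j) (mulVec_injective_of_isUnit (hAu j))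
    have h2 := (h1.smul (hw j)).posSemidef_add (hpsd j)
    simpa using h2
  have hBu : IsUnit B.det := by
    have h1 := (isUnit_iff_isUnit_det _).1 (hpd (Classical.arbitrary ι)).isUnit
    rw [det_mul, det_transpose] at h1
    exact isUnit_of_mul_isUnit_left h1
  have hBiu : IsUnit B⁻¹ := (isUnit_nonsing_inv_iff).2 ((isUnit_iff_isUnit_det _).2 hBu)
  have hT : ∀ j, (A j * B⁻¹).PosDef := fun j => by
    have h1 := (hpd j).conjTranspose_mul_mul_same (mulVec_injective_of_isUnit hBiu)
    have h2 : (B⁻¹)ᴴ * (Bᵀ * A j) * B⁻¹ = A j * B⁻¹ := by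
      rw [conjTranspose_eq_transpose_of_trivial, ← Matrix.mul_assoc, ← transpose_mul,
        mul_nonsing_inv B hBu, transpose_one, Matrix.one_mul]
    rwa [h2] at h1
  refine ⟨B * Bᵀ, fun j => A j * B⁻¹, ?_, hT, fun j => ?_, ?_⟩
  · simpa using PosDef.mul_conjTranspose_self B (vecMul_injective_of_isUnit
      ((isUnit_iff_isUnit_det _).2 hBu))
  · have h1 : (A j * B⁻¹)ᵀ = A j * B⁻¹ := (hT j).isHermitian
    calc A j * B⁻¹ * (B * Bᵀ) * (A j * B⁻¹) = A j * B⁻¹ * (B * Bᵀ) * (A j * B⁻¹)ᵀ := by rw [h1]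
      _ = (A j * (B⁻¹ * B)) * (A j * (B⁻¹ * B))ᵀ := by simp only [transpose_mul, Matrix.mul_assoc]
      _ = C j := by rw [nonsing_inv_mul B hBu, Matrix.mul_one, hA]
  · simp only [← smul_mul_assoc, ← Finset.sum_mul, ← hB]
    exact mul_nonsing_inv B hBu

/-- The defect in the variational characterization of the fidelity, as a trace of a
positive semidefinite matrix. -/
lemma trace_defect_nonneg {T S D : Matrix n n ℝ} (hT : T.PosDef) (hS : S.PosDef) (hD : D.PosDef) :
    0 ≤ (T * D).trace + (T⁻¹ * (S * D * S)).trace - 2 * (S * D).trace ∧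
    ((T * D).trace + (T⁻¹ * (S * D * S)).trace - 2 * (S * D).trace = 0 → T = S) := by
  obtain ⟨R, hR, hRD⟩ := hD.posSemidef.exists_mul_self_eq
  have hRt : Rᵀ = R := hR.isHermitian
  have hTt : Tᵀ = T := hT.isHermitian
  have hSt : Sᵀ = S := hS.isHermitian
  have hTd : IsUnit T.det := (isUnit_iff_isUnit_det _).1 hT.isUnit
  have hRu : IsUnit R := by
    rw [isUnit_iff_isUnit_det]
    have h1 := (isUnit_iff_isUnit_det _).1 hD.isUnit
    rw [← hRD, det_mul] at h1
    exact isUnit_of_mul_isUnit_left h1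
  have hpsd : (((T - S) * R)ᴴ * T⁻¹ * ((T - S) * R)).PosSemidef :=
    hT.inv.posSemidef.conjTranspose_mul_mul_same _
  have heq : (((T - S) * R)ᴴ * T⁻¹ * ((T - S) * R)).trace =
      (T * D).trace + (T⁻¹ * (S * D * S)).trace - 2 * (S * D).trace := by
    have h1 : ((T - S) * R)ᴴ * T⁻¹ * ((T - S) * R) =
        R * ((T - S) * T⁻¹ * (T - S)) * R := by
      simp only [conjTranspose_eq_transpose_of_trivial, transpose_mul, transpose_sub, hRt, hTt,
        hSt, Matrix.mul_assoc]
    have h2 : (T - S) * T⁻¹ * (T - S) = T - S - S + S * T⁻¹ * S := by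
      rw [sub_mul, mul_nonsing_inv T hTd, sub_mul, Matrix.one_mul, mul_sub, Matrix.mul_assoc S,
        nonsing_inv_mul T hTd, Matrix.mul_one]
      abel
    have h3 : (S * T⁻¹ * S * D).trace = (T⁻¹ * (S * D * S)).trace := by
      rw [Matrix.mul_assoc, Matrix.mul_assoc, trace_mul_comm]
      simp only [Matrix.mul_assoc]
    rw [h1, trace_mul_cycle, hRD, trace_mul_comm, h2]
    simp only [add_mul, sub_mul, trace_add, trace_sub, h3]
    ring
  refine ⟨heq ▸ hpsd.trace_nonneg, fun h0 => ?_⟩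
  have h1 := hpsd.trace_eq_zero_iff.1 (heq.trans h0)
  have hpd := hT.inv
  by_contra hne
  have hne' : (T - S) * R ≠ 0 := fun h => hne <| sub_eq_zero.1 <| by
    simpa using (hRu.mul_left_eq_zero).1 h
  apply hne'
  ext i j
  have h2 : (((T - S) * R)ᴴ * T⁻¹ * ((T - S) * R)) j j = 0 := by rw [h1]; rfl
  by_contra hij
  have hcol : ((T - S) * R).col j ≠ 0 := fun h => hij (congrFun h i)
  have h3 := hpd.dotProduct_mulVec_pos hcol
  refine h3.ne' ?_
  rw [← h2, Matrix.mul_assoc, mul_apply]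
  rfl

lemma posDef_transport_family_unique [Nonempty ι] {C : ι → Matrix n n ℝ} {w : ι → ℝ}
    (hw : ∀ j, 0 < w j) {S S' : Matrix n n ℝ} {T T' : ι → Matrix n n ℝ}
    (hS : S.PosDef) (hT : ∀ j, (T j).PosDef) (hTC : ∀ j, T j * S * T j = C j)
    (hTw : ∑ j, w j • T j = 1)
    (hS' : S'.PosDef) (hT' : ∀ j, (T' j).PosDef) (hTC' : ∀ j, T' j * S' * T' j = C j)
    (hTw' : ∑ j, w j • T' j = 1) : S = S' := by
  have hu : ∀ j, IsUnit (T j).det := fun j => (isUnit_iff_isUnit_det _).1 (hT j).isUnit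
  have hu' : ∀ j, IsUnit (T' j).det := fun j => (isUnit_iff_isUnit_det _).1 (hT' j).isUnit
  have hsum : ∀ {U : ι → Matrix n n ℝ} (D : Matrix n n ℝ), ∑ j, w j • U j = 1 →
      ∑ j, w j * (U j * D).trace = D.trace := fun {U} D hU => by
    conv_rhs => rw [← Matrix.one_mul D, ← hU, Finset.sum_mul, trace_sum]
    simp
  have hcancel : ∀ j, (T j)⁻¹ * C j = S * T j := fun j => by
    rw [← hTC j, Matrix.mul_assoc, ← Matrix.mul_assoc, nonsing_inv_mul _ (hu j), Matrix.one_mul]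
  have hcancel' : ∀ j, (T' j)⁻¹ * C j = S' * T' j := fun j => by
    rw [← hTC' j, Matrix.mul_assoc, ← Matrix.mul_assoc, nonsing_inv_mul _ (hu' j), Matrix.one_mul]
  let f : ι → ℝ := fun j => (T j * S').trace + (T j * S).trace - 2 * (T' j * S').trace
  let g : ι → ℝ := fun j => (T' j * S).trace + (T' j * S').trace - 2 * (T j * S).trace
  have hf : ∀ j, 0 ≤ f j ∧ (f j = 0 → T j = T' j) := fun j => by
    have h := trace_defect_nonneg (hT j) (hT' j) hS'
    rwa [hTC', hcancel, trace_mul_comm S] at h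
  have hg : ∀ j, 0 ≤ g j := fun j => by
    have h := trace_defect_nonneg (hT' j) (hT j) hS
    rw [hTC, hcancel', trace_mul_comm S'] at h
    exact h.1
  have h0 : ∑ j, w j * (f j + g j) = 0 := by
    have : ∀ j, w j * (f j + g j) = w j * (T j * S').trace + w j * (T' j * S).trace
        - w j * (T j * S).trace - w j * (T' j * S').trace := fun j => by
      simp only [f, g]; ring
    simp only [this, Finset.sum_sub_distrib, Finset.sum_add_distrib, hsum _ hTw, hsum _ hTw']
    ring
  let j : ι := Classical.arbitrary ι
  have h1 := (Finset.sum_eq_zero_iff_of_nonneg fun i _ =>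
    mul_nonneg (hw i).le (add_nonneg (hf i).1 (hg i))).1 h0 j (Finset.mem_univ j)
  have h2 : f j + g j = 0 := (mul_eq_zero.1 h1).resolve_left (hw j).ne'
  have h3 : T j = T' j := (hf j).2 (by linarith [(hf j).1, hg j])
  have h4 : T j * S * T j = T j * S' * T j := by rw [hTC, h3, hTC']
  exact (hT j).isUnit.mul_left_cancel ((hT j).isUnit.mul_right_cancel h4)

end
end Matrix

section GaussianMeasure
variable {d : ℕ}

lemma inner_toEuclideanLin_toEuclideanLin (A B : Matrix (Fin d) (Fin d) ℝ)
    (u v : EuclideanSpace ℝ (Fin d)) :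
    ⟪A.toEuclideanLin u, B.toEuclideanLin v⟫ = ⟪u, (Aᵀ * B).toEuclideanLin v⟫ := by
  rw [← conjTranspose_eq_transpose_of_trivial, toLpLin_mul_same, LinearMap.comp_apply,
    toEuclideanLin_conjTranspose_eq_adjoint, LinearMap.adjoint_inner_right]

lemma inner_toEuclideanLin_toEuclideanLin_conj (A B : Matrix (Fin d) (Fin d) ℝ)
    (u : EuclideanSpace ℝ (Fin d)) :
    ⟪A.toEuclideanLin u, B.toEuclideanLin (A.toEuclideanLin u)⟫ =
      ⟪u, (Aᵀ * B * A).toEuclideanLin u⟫ := by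
  rw [inner_toEuclideanLin_toEuclideanLin, toLpLin_mul_same 2 (Aᵀ * B) A,
    LinearMap.comp_apply]

lemma continuous_toEuclideanLin (A : Matrix (Fin d) (Fin d) ℝ) :
    Continuous fun x => A.toEuclideanLin x :=
  LinearMap.continuous_of_finiteDimensional _

lemma measurable_gaussianMeasure_density (m : EuclideanSpace ℝ (Fin d))
    (C : Matrix (Fin d) (Fin d) ℝ) :
    Measurable fun x => ENNReal.ofReal (Real.sqrt (((2 * Real.pi) ^ d * C.det)⁻¹) *
      Real.exp (-(1 / 2 : ℝ) * ⟪x - m, (C⁻¹).toEuclideanLin (x - m)⟫)) := by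
  have := continuous_toEuclideanLin C⁻¹
  exact (by fun_prop : Continuous fun x => Real.sqrt (((2 * Real.pi) ^ d * C.det)⁻¹) *
      Real.exp (-(1 / 2 : ℝ) * ⟪x - m, (C⁻¹).toEuclideanLin (x - m)⟫)).measurable.ennreal_ofReal

lemma volume_map_affine {A : Matrix (Fin d) (Fin d) ℝ} (hA : A.det ≠ 0)
    (m b : EuclideanSpace ℝ (Fin d)) :
    (volume : Measure (EuclideanSpace ℝ (Fin d))).map (fun x => b + A.toEuclideanLin (x - m)) =
      ENNReal.ofReal |A.det⁻¹| • volume := by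
  have hAm := (continuous_toEuclideanLin A).measurable
  have h1 : (fun x => b + A.toEuclideanLin (x - m)) =
      (fun x => b + x) ∘ (fun x => A.toEuclideanLin x) ∘ fun x => x - m := rfl
  rw [h1, ← Measure.map_map (by fun_prop) (by fun_prop), ← Measure.map_map hAm (by fun_prop),
    (measurePreserving_sub_right volume m).map_eq,
    Measure.map_linearMap_addHaar_eq_smul_addHaar _ (by rwa [LinearMap.det_toLpLin]),
    Measure.map_smul, (measurePreserving_add_left volume b).map_eq, LinearMap.det_toLpLin]

lemma gaussianMeasure_map_affine {A : Matrix (Fin d) (Fin d) ℝ} (hA : A.det ≠ 0)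
    (C : Matrix (Fin d) (Fin d) ℝ) (m b : EuclideanSpace ℝ (Fin d)) :
    (gaussianMeasure d m C).map (fun x => b + A.toEuclideanLin (x - m)) =
      gaussianMeasure d b (A * C * Aᵀ) := by
  have hAm := (continuous_toEuclideanLin A).measurable
  have hf : Measurable fun x => b + A.toEuclideanLin (x - m) := by fun_prop
  have hvol : (volume : Measure (EuclideanSpace ℝ (Fin d))) = ENNReal.ofReal |A.det| •
      (volume : Measure (EuclideanSpace ℝ (Fin d))).map
        (fun x => b + A.toEuclideanLin (x - m)) := by
    rw [volume_map_affine hA, smul_smul, ← ENNReal.ofReal_mul (abs_nonneg _), ← abs_mul,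
      mul_inv_cancel₀ hA]
    simp
  ext s hs
  rw [Measure.map_apply hf hs, gaussianMeasure, gaussianMeasure, withDensity_apply _ (hf hs),
    withDensity_apply _ hs]
  conv_rhs => rw [hvol]
  rw [Measure.restrict_smul, lintegral_smul_measure,
    setLIntegral_map hs (measurable_gaussianMeasure_density _ _) hf, smul_eq_mul,
    ← lintegral_const_mul' _ _ ENNReal.ofReal_ne_top]
  congr 1 with x
  rw [← ENNReal.ofReal_mul (abs_nonneg _), add_sub_cancel_left,
    inner_toEuclideanLin_toEuclideanLin_conj]
  congr 1
  have h1 : Aᵀ * (A * C * Aᵀ)⁻¹ * A = C⁻¹ := by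
    have hAu : IsUnit A.det := hA.isUnit
    have hAu' : IsUnit Aᵀ.det := by rwa [det_transpose]
    rw [Matrix.mul_inv_rev, Matrix.mul_inv_rev, ← Matrix.mul_assoc,
      mul_nonsing_inv _ hAu', Matrix.one_mul, Matrix.mul_assoc, nonsing_inv_mul _ hAu, Matrix.mul_one]
  have h2 : √(((2 * Real.pi) ^ d * (A * C * Aᵀ).det)⁻¹) =
      √(((2 * Real.pi) ^ d * C.det)⁻¹) * |A.det|⁻¹ := by
    have : ((2 * Real.pi) ^ d * (A * C * Aᵀ).det)⁻¹ =
        ((2 * Real.pi) ^ d * C.det)⁻¹ * (A.det⁻¹) ^ 2 := by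
      rw [det_mul, det_mul, det_transpose]
      simp only [mul_inv]
      ring
    rw [this, Real.sqrt_mul' _ (sq_nonneg _), Real.sqrt_sq_eq_abs, abs_inv]
  rw [h1, h2]
  have : |A.det| ≠ 0 := abs_ne_zero.2 hA
  field_simp

lemma gaussianMeasure_zero_one : gaussianMeasure d 0 1 =
    volume.withDensity fun x => ENNReal.ofReal (Real.sqrt (((2 * Real.pi) ^ d)⁻¹) *
      Real.exp (-(1 / 2 : ℝ) * ‖x‖ ^ 2)) := by
  simp [gaussianMeasure, toLpLin_one]

lemma integrable_exp_neg_mul_sq_norm {c : ℝ} (hc : 0 < c) :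
    Integrable fun x : EuclideanSpace ℝ (Fin d) => Real.exp (-c * ‖x‖ ^ 2) := by
  refine Integrable.of_integral_ne_zero ?_
  rw [GaussianFourier.integral_rexp_neg_mul_sq_norm hc]
  exact (Real.rpow_pos_of_pos (by positivity) _).ne'

lemma isProbabilityMeasure_gaussianMeasure_zero_one :
    IsProbabilityMeasure (gaussianMeasure d 0 1) := by
  refine ⟨?_⟩
  rw [gaussianMeasure_zero_one, withDensity_apply _ .univ, setLIntegral_univ,
    ← ofReal_integral_eq_lintegral_ofReal
      ((integrable_exp_neg_mul_sq_norm (by norm_num)).const_mul _)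
      (.of_forall fun x => by positivity),
    integral_const_mul, GaussianFourier.integral_rexp_neg_mul_sq_norm (by norm_num)]
  have h1 : Real.pi / (1 / 2) = 2 * Real.pi := by ring
  have h2 : (2 * Real.pi) ^ ((Module.finrank ℝ (EuclideanSpace ℝ (Fin d)) : ℝ) / 2) =
      √((2 * Real.pi) ^ d) := by
    rw [Real.sqrt_eq_rpow, ← Real.rpow_natCast_mul (by positivity)]
    simp [div_eq_mul_inv]
  rw [h1, h2, Real.sqrt_inv, inv_mul_cancel₀ (by positivity), ENNReal.ofReal_one]

lemma memLp_gaussianMeasure_zero_one :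
    MemLp (fun x => x) 2 (gaussianMeasure d 0 1) := by
  rw [memLp_two_iff_integrable_sq_norm (by fun_prop), gaussianMeasure_zero_one,
    integrable_withDensity_iff (Measurable.ennreal_ofReal (by fun_prop))
      (.of_forall fun _ => ENNReal.ofReal_lt_top)]
  refine Integrable.mono' ((integrable_exp_neg_mul_sq_norm (c := 1 / 4) (by norm_num)).const_mul
    (4 * √(((2 * Real.pi) ^ d)⁻¹))) (by fun_prop) (.of_forall fun x => ?_)
  rw [ENNReal.toReal_ofReal (by positivity), Real.norm_of_nonneg (by positivity)]
  have h1 : ‖x‖ ^ 2 ≤ 4 * Real.exp ((1 / 4) * ‖x‖ ^ 2) := by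
    linarith [Real.add_one_le_exp ((1 / 4) * ‖x‖ ^ 2)]
  calc ‖x‖ ^ 2 * (√(((2 * Real.pi) ^ d)⁻¹) * Real.exp (-(1 / 2 : ℝ) * ‖x‖ ^ 2))
      ≤ 4 * Real.exp ((1 / 4) * ‖x‖ ^ 2) *
        (√(((2 * Real.pi) ^ d)⁻¹) * Real.exp (-(1 / 2 : ℝ) * ‖x‖ ^ 2)) := by gcongr
    _ = 4 * √(((2 * Real.pi) ^ d)⁻¹) *
        (Real.exp ((1 / 4) * ‖x‖ ^ 2) * Real.exp (-(1 / 2 : ℝ) * ‖x‖ ^ 2)) := by ring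
    _ = 4 * √(((2 * Real.pi) ^ d)⁻¹) * Real.exp (-(1 / 4) * ‖x‖ ^ 2) := by
      rw [← Real.exp_add]; ring_nf

lemma Matrix.PosDef.exists_det_ne_zero_mul_transpose_eq {C : Matrix (Fin d) (Fin d) ℝ}
    (hC : C.PosDef) : ∃ R : Matrix (Fin d) (Fin d) ℝ, R.det ≠ 0 ∧ R * Rᵀ = C := by
  obtain ⟨R, hR, hRC⟩ := hC.posSemidef.exists_mul_self_eq
  have hRt : Rᵀ = R := hR.isHermitian
  refine ⟨R, fun h => hC.det_pos.ne' ?_, by rw [hRt, hRC]⟩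
  rw [← hRC, det_mul, h, zero_mul]

lemma gaussianMeasure_eq_map {R : Matrix (Fin d) (Fin d) ℝ} (hR : R.det ≠ 0)
    (m : EuclideanSpace ℝ (Fin d)) :
    gaussianMeasure d m (R * Rᵀ) =
      (gaussianMeasure d 0 1).map fun x => m + R.toEuclideanLin x := by
  have h := gaussianMeasure_map_affine hR 1 0 m
  simpa using h.symm

lemma isProbabilityMeasure_gaussianMeasure {C : Matrix (Fin d) (Fin d) ℝ} (hC : C.PosDef)
    (m : EuclideanSpace ℝ (Fin d)) : IsProbabilityMeasure (gaussianMeasure d m C) := by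
  obtain ⟨R, hR, rfl⟩ := hC.exists_det_ne_zero_mul_transpose_eq
  have := isProbabilityMeasure_gaussianMeasure_zero_one (d := d)
  rw [gaussianMeasure_eq_map hR]
  exact Measure.isProbabilityMeasure_map
    (continuous_const.add (continuous_toEuclideanLin R)).measurable.aemeasurable

lemma memLp_toEuclideanLin {Ω : Type*} [MeasurableSpace Ω] {μ : Measure Ω}
    {f : Ω → EuclideanSpace ℝ (Fin d)} (hf : MemLp f 2 μ) (A : Matrix (Fin d) (Fin d) ℝ) :
    MemLp (fun x => A.toEuclideanLin (f x)) 2 μ :=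
  (LinearMap.toContinuousLinearMap A.toEuclideanLin).comp_memLp' hf

lemma memLp_gaussianMeasure {C : Matrix (Fin d) (Fin d) ℝ} (hC : C.PosDef)
    (m : EuclideanSpace ℝ (Fin d)) : MemLp (fun x => x) 2 (gaussianMeasure d m C) := by
  obtain ⟨R, hR, rfl⟩ := hC.exists_det_ne_zero_mul_transpose_eq
  have := isProbabilityMeasure_gaussianMeasure_zero_one (d := d)
  have hR' := (continuous_toEuclideanLin R).measurable
  rw [gaussianMeasure_eq_map hR, memLp_map_measure_iff (by fun_prop) (by fun_prop)]
  exact (memLp_const m).add (memLp_toEuclideanLin memLp_gaussianMeasure_zero_one R)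

end GaussianMeasure

section Kantorovich
variable {d : ℕ}

lemma integrable_inner_of_memLp {Ω E : Type*} [MeasurableSpace Ω] {μ : Measure Ω}
    [NormedAddCommGroup E] [InnerProductSpace ℝ E] {f g : Ω → E}
    (hf : MemLp f 2 μ) (hg : MemLp g 2 μ) : Integrable (fun x => ⟪f x, g x⟫) μ :=
  (hf.norm.integrable_mul hg.norm).mono' (hf.1.inner hg.1)
    (.of_forall fun x => norm_inner_le_norm (f x) (g x))

/-- Weak Kantorovich duality for the quadratic cost. -/
lemma integral_add_integral_le_kantorovich {α β : Measure (EuclideanSpace ℝ (Fin d))}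
    [IsProbabilityMeasure α] [IsProbabilityMeasure β]
    (hα : MemLp (fun x => x) 2 α) (hβ : MemLp (fun x => x) 2 β)
    {φ ψ : EuclideanSpace ℝ (Fin d) → ℝ} (hφ : Integrable φ α) (hψ : Integrable ψ β)
    (h : ∀ x y, φ x + ψ y ≤ ‖x - y‖ ^ 2) :
    ∫ x, φ x ∂α + ∫ y, ψ y ∂β ≤ kantorovich d α β := by
  refine le_csInf ⟨_, α.prod β, inferInstance, by simp, by simp, rfl⟩ ?_
  rintro _ ⟨π, hπ, rfl, rfl, rfl⟩
  rw [memLp_map_measure_iff (by fun_prop) (by fun_prop)] at hα hβ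
  have hφ' : Integrable (fun p => φ (p.1 : EuclideanSpace ℝ (Fin d))) π :=
    hφ.comp_measurable measurable_fst
  have hψ' : Integrable (fun p => ψ (p.2 : EuclideanSpace ℝ (Fin d))) π :=
    hψ.comp_measurable measurable_snd
  rw [integral_map (by fun_prop) hφ.1, integral_map (by fun_prop) hψ.1,
    ← integral_add hφ' hψ']
  refine integral_mono (hφ'.add hψ') ?_ fun p => h p.1 p.2
  exact (memLp_two_iff_integrable_sq_norm (by fun_prop)).1 (hα.sub hβ)

lemma kantorovich_map_le {α : Measure (EuclideanSpace ℝ (Fin d))} [IsProbabilityMeasure α]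
    {g : EuclideanSpace ℝ (Fin d) → EuclideanSpace ℝ (Fin d)} (hg : Measurable g)
    {φ ψ : EuclideanSpace ℝ (Fin d) → ℝ} (hφ : Integrable φ α) (hψ : Integrable ψ (α.map g))
    (h : ∀ x, ‖x - g x‖ ^ 2 = φ x + ψ (g x)) :
    kantorovich d α (α.map g) ≤ ∫ x, φ x ∂α + ∫ y, ψ y ∂(α.map g) := by
  have hm : Measurable fun x => (x, g x) := by fun_prop
  refine csInf_le ⟨0, ?_⟩ ⟨α.map fun x => (x, g x),
    Measure.isProbabilityMeasure_map hm.aemeasurable, ?_, ?_, ?_⟩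
  · rintro _ ⟨π, -, -, -, rfl⟩
    positivity
  · rw [Measure.map_map measurable_fst hm]
    exact Measure.map_id
  · rw [Measure.map_map measurable_snd hm]
    rfl
  · have hψ' : Integrable (fun x => ψ (g x)) α := hψ.comp_measurable hg
    rw [integral_map hm.aemeasurable (by fun_prop), integral_map hg.aemeasurable hψ.1,
      ← integral_add hφ hψ']
    simp only [h]

/-- The quadratic function `x ↦ ‖x - m‖² - ⟨x - m, T (x - m)⟩ + 2 ⟨x - m, δ⟩`, the Kantorovich
potential attached to an affine transport map with linear part `T`. -/
noncomputable def transportPotential (T : Matrix (Fin d) (Fin d) ℝ)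
    (m δ x : EuclideanSpace ℝ (Fin d)) : ℝ :=
  ⟪x - m, x - m⟫ - ⟪x - m, T.toEuclideanLin (x - m)⟫ + 2 * ⟪x - m, δ⟫

lemma integrable_transportPotential {μ : Measure (EuclideanSpace ℝ (Fin d))}
    [IsProbabilityMeasure μ] (hμ : MemLp (fun x => x) 2 μ) (T : Matrix (Fin d) (Fin d) ℝ)
    (m δ : EuclideanSpace ℝ (Fin d)) : Integrable (transportPotential T m δ) μ := by
  have hsub : MemLp (fun x => x - m) 2 μ := hμ.sub (memLp_const m)
  exact ((integrable_inner_of_memLp hsub hsub).sub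
    (integrable_inner_of_memLp hsub (memLp_toEuclideanLin hsub T))).add
    ((integrable_inner_of_memLp hsub (memLp_const δ)).const_mul 2)

lemma norm_sub_sq_eq_transportPotential {T : Matrix (Fin d) (Fin d) ℝ} (hT : T.PosDef)
    (m m' x y : EuclideanSpace ℝ (Fin d)) :
    ‖x - y‖ ^ 2 = transportPotential T m (m - m') x +
      (transportPotential T⁻¹ m' (m' - m) y + ‖m - m'‖ ^ 2) +
      ⟪T.toEuclideanLin (x - m) - (y - m'),
        T⁻¹.toEuclideanLin (T.toEuclideanLin (x - m) - (y - m'))⟫ := by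
  have hTt : Tᵀ = T := hT.isHermitian
  have hTu : IsUnit T.det := (isUnit_iff_isUnit_det _).1 hT.isUnit
  have hxy : x - y = (x - m) - (y - m') + (m - m') := by abel
  rw [hxy, ← neg_sub m m', ← real_inner_self_eq_norm_sq, ← real_inner_self_eq_norm_sq,
    transportPotential, transportPotential]
  generalize x - m = u, y - m' = v, m - m' = δ
  have h1 : T⁻¹.toEuclideanLin (T.toEuclideanLin u) = u := by
    rw [← LinearMap.comp_apply, ← toLpLin_mul_same, nonsing_inv_mul T hTu, toLpLin_one,
      LinearMap.id_apply]
  have h2 : ⟪T.toEuclideanLin u, T⁻¹.toEuclideanLin v⟫ = ⟪u, v⟫ := by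
    rw [inner_toEuclideanLin_toEuclideanLin, hTt, mul_nonsing_inv T hTu, toLpLin_one,
      LinearMap.id_apply]
  simp only [map_sub, inner_sub_left, inner_sub_right, inner_add_left, inner_add_right,
    inner_neg_right, h1, h2, real_inner_comm u v, real_inner_comm u δ, real_inner_comm v δ,
    real_inner_comm u (T.toEuclideanLin u)]
  ring

lemma sum_mul_transportPotential {k : ℕ} {w : Fin k → ℝ} (hw1 : ∑ j, w j = 1)
    {T : Fin k → Matrix (Fin d) (Fin d) ℝ} (hT : ∑ j, w j • T j = 1)
    (m : Fin k → EuclideanSpace ℝ (Fin d)) (x : EuclideanSpace ℝ (Fin d)) :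
    ∑ j, w j * transportPotential (T j) (∑ i, w i • m i) ((∑ i, w i • m i) - m j) x = 0 := by
  simp only [transportPotential]
  set b := ∑ i, w i • m i with hb
  have h0 : ∑ j, w j • (T j).toEuclideanLin (x - b) = x - b := by
    have h := congrArg (fun M => M.toEuclideanLin (x - b)) hT
    simpa only [map_sum, map_smul, LinearMap.sum_apply, LinearMap.smul_apply, toLpLin_one,
      LinearMap.id_apply] using h
  have h1 : ∑ j, w j * ⟪x - b, (T j).toEuclideanLin (x - b)⟫ = ⟪x - b, x - b⟫ := by
    simp only [← inner_smul_right_eq_smul, ← smul_eq_mul, ← inner_sum]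
    rw [h0]
  have h2 : ∑ j, w j * ⟪x - b, b - m j⟫ = 0 := by
    simp only [← inner_smul_right_eq_smul, ← smul_eq_mul, ← inner_sum, smul_sub,
      Finset.sum_sub_distrib, ← Finset.sum_smul, hw1, ← hb]
    simp
  have h3 : ∑ j, w j * ⟪x - b, x - b⟫ = ⟪x - b, x - b⟫ := by rw [← Finset.sum_mul, hw1, one_mul]
  have h4 : ∀ j, w j * (⟪x - b, x - b⟫ - ⟪x - b, (T j).toEuclideanLin (x - b)⟫ +
      2 * ⟪x - b, b - m j⟫) = w j * ⟪x - b, x - b⟫ -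
        w j * ⟪x - b, (T j).toEuclideanLin (x - b)⟫ + 2 * (w j * ⟪x - b, b - m j⟫) := fun j => by
    ring
  simp only [h4, Finset.sum_add_distrib, Finset.sum_sub_distrib, ← Finset.mul_sum, h1, h2, h3]
  ring

end Kantorovich

lemma isGaussianBarycenterFixedPoint_iff {d k : ℕ} {w : Fin k → ℝ}
    {Cov : Fin k → Matrix (Fin d) (Fin d) ℝ} (hCov : ∀ j, (Cov j).PosDef)
    {Cs : Matrix (Fin d) (Fin d) ℝ} (hCs : Cs.PosDef) :
    IsGaussianBarycenterFixedPoint w Cov Cs ↔ ∃ T : Fin k → Matrix (Fin d) (Fin d) ℝ,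
      (∀ j, (T j).PosDef) ∧ (∀ j, T j * Cs * T j = Cov j) ∧ ∑ j, w j • T j = 1 := by
  constructor
  · rintro ⟨R, ⟨hR, hRC⟩, N, hN, hNsum⟩
    have hRt : Rᵀ = R := hR.isHermitian
    have hRu : IsUnit R.det := by
      have h1 := (isUnit_iff_isUnit_det _).1 hCs.isUnit
      rw [← hRC, det_mul] at h1
      exact isUnit_of_mul_isUnit_left h1
    have hRiu : IsUnit R⁻¹ := isUnit_nonsing_inv_iff.2 ((isUnit_iff_isUnit_det _).2 hRu)
    refine ⟨fun j => R⁻¹ * N j * R⁻¹, fun j => ?_, fun j => ?_, ?_⟩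
    · have hNu : IsUnit (N j) := by
        have h1 := ((isUnit_iff_isUnit_det _).1 (hCov j).isUnit)
        have h2 : IsUnit (N j * N j).det := by
          rw [(hN j).2, det_mul, det_mul]
          exact (hRu.mul h1).mul hRu
        rw [det_mul] at h2
        exact (isUnit_iff_isUnit_det _).2 (isUnit_of_mul_isUnit_left h2)
      have h3 := ((hN j).1.posDef_iff_isUnit.2 hNu).conjTranspose_mul_mul_same
        (mulVec_injective_of_isUnit hRiu)
      rwa [conjTranspose_eq_transpose_of_trivial, transpose_nonsing_inv, hRt] at h3
    · calc R⁻¹ * N j * R⁻¹ * Cs * (R⁻¹ * N j * R⁻¹)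
          = R⁻¹ * N j * (R⁻¹ * R) * (R * R⁻¹) * N j * R⁻¹ := by
            rw [← hRC]; simp only [Matrix.mul_assoc]
        _ = R⁻¹ * (N j * N j) * R⁻¹ := by
            rw [nonsing_inv_mul _ hRu, mul_nonsing_inv _ hRu, Matrix.mul_one, Matrix.mul_one]
            simp only [Matrix.mul_assoc]
        _ = (R⁻¹ * R) * Cov j * (R * R⁻¹) := by rw [(hN j).2]; simp only [Matrix.mul_assoc]
        _ = Cov j := by
            rw [nonsing_inv_mul _ hRu, mul_nonsing_inv _ hRu, Matrix.mul_one, Matrix.one_mul]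
    · calc ∑ j, w j • (R⁻¹ * N j * R⁻¹) = R⁻¹ * (∑ j, w j • N j) * R⁻¹ := by
            simp [Finset.mul_sum, Finset.sum_mul]
        _ = (R⁻¹ * R) * (R * R⁻¹) := by rw [← hNsum, ← hRC]; simp only [Matrix.mul_assoc]
        _ = 1 := by rw [nonsing_inv_mul _ hRu, mul_nonsing_inv _ hRu, Matrix.mul_one]
  · rintro ⟨T, hT, hTC, hTw⟩
    obtain ⟨R, hR, hRC⟩ := hCs.posSemidef.exists_mul_self_eq
    have hRt : Rᴴ = R := hR.isHermitian
    refine ⟨R, ⟨hR, hRC⟩, fun j => R * T j * R, fun j => ⟨?_, ?_⟩, ?_⟩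
    · have h1 := (hT j).posSemidef.conjTranspose_mul_mul_same R
      rwa [hRt] at h1
    · calc R * T j * R * (R * T j * R) = R * (T j * (R * R) * T j) * R := by
            simp only [Matrix.mul_assoc]
        _ = R * Cov j * R := by rw [hRC, hTC]
    · calc Cs = R * (∑ j, w j • T j) * R := by rw [hTw, Matrix.mul_one, hRC]
        _ = ∑ j, w j • (R * T j * R) := by simp [Finset.mul_sum, Finset.sum_mul]

lemma sum_mul_kantorovich_gaussianMeasure_le {d k : ℕ} {m : Fin k → EuclideanSpace ℝ (Fin d)}
    {Cov : Fin k → Matrix (Fin d) (Fin d) ℝ} (hCov : ∀ j, (Cov j).PosDef)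
    {w : Fin k → ℝ} (hw : ∀ j, 0 < w j) (hw1 : ∑ j, w j = 1)
    {Cs : Matrix (Fin d) (Fin d) ℝ} (hCs : Cs.PosDef) {T : Fin k → Matrix (Fin d) (Fin d) ℝ}
    (hT : ∀ j, (T j).PosDef) (hTC : ∀ j, T j * Cs * T j = Cov j) (hTw : ∑ j, w j • T j = 1)
    {ν : Measure (EuclideanSpace ℝ (Fin d))} [IsProbabilityMeasure ν]
    (hν : MemLp (fun x => x) 2 ν) :
    ∑ j, w j * kantorovich d (gaussianMeasure d (∑ j, w j • m j) Cs)
        (gaussianMeasure d (m j) (Cov j)) ≤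
      ∑ j, w j * kantorovich d ν (gaussianMeasure d (m j) (Cov j)) := by
  set b := ∑ j, w j • m j with hb
  let φ : Fin k → EuclideanSpace ℝ (Fin d) → ℝ := fun j => transportPotential (T j) b (b - m j)
  let ψ : Fin k → EuclideanSpace ℝ (Fin d) → ℝ := fun j y =>
    transportPotential (T j)⁻¹ (m j) (m j - b) y + ‖b - m j‖ ^ 2
  have hprob : ∀ j, IsProbabilityMeasure (gaussianMeasure d (m j) (Cov j)) := fun j =>
    isProbabilityMeasure_gaussianMeasure (hCov j) (m j)
  have hprobs : IsProbabilityMeasure (gaussianMeasure d b Cs) :=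
    isProbabilityMeasure_gaussianMeasure hCs b
  have hψ : ∀ j, Integrable (ψ j) (gaussianMeasure d (m j) (Cov j)) := fun j =>
    (integrable_transportPotential (memLp_gaussianMeasure (hCov j) (m j)) _ _ _).add
      (integrable_const _)
  have hzero : ∀ (μ : Measure (EuclideanSpace ℝ (Fin d))) [IsProbabilityMeasure μ],
      MemLp (fun x => x) 2 μ → ∑ j, w j * ∫ x, φ j x ∂μ = 0 := fun μ _ hμ => by
    simp only [← integral_const_mul]
    rw [← integral_finsetSum _ fun j _ =>
      (integrable_transportPotential hμ (T j) b (b - m j)).const_mul (w j)]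
    simp [hb, sum_mul_transportPotential hw1 hTw]
  have hupper : ∀ j, kantorovich d (gaussianMeasure d b Cs) (gaussianMeasure d (m j) (Cov j)) ≤
      ∫ x, φ j x ∂(gaussianMeasure d b Cs) +
        ∫ y, ψ j y ∂(gaussianMeasure d (m j) (Cov j)) := fun j => by
    have hTt : (T j)ᵀ = T j := (hT j).isHermitian
    have hmap := gaussianMeasure_map_affine (hT j).det_pos.ne' Cs b (m j)
    rw [hTt, hTC] at hmap
    have hmeas := (continuous_toEuclideanLin (T j)).measurable
    have hψj := hψ j
    rw [← hmap] at hψj ⊢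
    refine kantorovich_map_le (by fun_prop)
      (integrable_transportPotential (memLp_gaussianMeasure hCs b) _ _ _) hψj fun x => ?_
    rw [norm_sub_sq_eq_transportPotential (hT j) b (m j)]
    simp [φ, ψ]
  have hlower : ∀ j, ∫ x, φ j x ∂ν + ∫ y, ψ j y ∂(gaussianMeasure d (m j) (Cov j)) ≤
      kantorovich d ν (gaussianMeasure d (m j) (Cov j)) := fun j => by
    refine integral_add_integral_le_kantorovich hν (memLp_gaussianMeasure (hCov j) (m j))
      (integrable_transportPotential hν _ _ _) (hψ j) fun x y => ?_
    rw [norm_sub_sq_eq_transportPotential (hT j) b (m j)]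
    exact le_add_of_nonneg_right
      ((isPositive_toEuclideanLin_iff.2 (hT j).inv.posSemidef).inner_nonneg_right _)
  calc ∑ j, w j * kantorovich d (gaussianMeasure d b Cs) (gaussianMeasure d (m j) (Cov j))
      ≤ ∑ j, w j * (∫ x, φ j x ∂(gaussianMeasure d b Cs) +
          ∫ y, ψ j y ∂(gaussianMeasure d (m j) (Cov j))) :=
        Finset.sum_le_sum fun j _ => mul_le_mul_of_nonneg_left (hupper j) (hw j).le
    _ = ∑ j, w j * (∫ x, φ j x ∂ν + ∫ y, ψ j y ∂(gaussianMeasure d (m j) (Cov j))) := by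
        simp only [mul_add, Finset.sum_add_distrib, hzero ν hν,
          hzero _ (memLp_gaussianMeasure hCs b)]
    _ ≤ _ := Finset.sum_le_sum fun j _ => mul_le_mul_of_nonneg_left (hlower j) (hw j).le

/-- For Gaussian measures `μ j = N(m j, C j)` with positive definite
covariances and positive weights summing to one, the map
`Ψ(C) = ∑ j, w j • (C^{1/2} C j C^{1/2})^{1/2}` has a unique positive definite fixed point
`C*`, and the Gaussian `N(∑ j, w j • m j, C*)` minimizes the barycenter objective
`ν ↦ ∑ j, w j * L(ν, μ j)` over probability measures with finite second moment. -/
theorem gaussian_barycenter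
    (d k : ℕ) (m : Fin k → EuclideanSpace ℝ (Fin d))
    (Cov : Fin k → Matrix (Fin d) (Fin d) ℝ) (hCov : ∀ j, (Cov j).PosDef)
    (w : Fin k → ℝ) (hw : ∀ j, 0 < w j) (hw1 : ∑ j, w j = 1) :
    (∃! Cs : Matrix (Fin d) (Fin d) ℝ,
      Cs.PosDef ∧ IsGaussianBarycenterFixedPoint w Cov Cs) ∧
    ∀ Cs : Matrix (Fin d) (Fin d) ℝ,
      Cs.PosDef → IsGaussianBarycenterFixedPoint w Cov Cs →
      ∀ ν : Measure (EuclideanSpace ℝ (Fin d)), IsProbabilityMeasure ν →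
        Integrable (fun x => ‖x‖ ^ 2) ν →
        ∑ j, w j * kantorovich d (gaussianMeasure d (∑ j, w j • m j) Cs)
            (gaussianMeasure d (m j) (Cov j)) ≤
          ∑ j, w j * kantorovich d ν (gaussianMeasure d (m j) (Cov j)) := by
  have hk : Nonempty (Fin k) := by
    by_contra h
    rw [not_nonempty_iff] at h
    simp at hw1
  refine ⟨?_, fun Cs hCs hfix ν _ hν => ?_⟩
  · obtain ⟨S, T, hS, hT, hTC, hTw⟩ := exists_posDef_transport_family hCov hw
    refine ⟨S, ⟨hS, (isGaussianBarycenterFixedPoint_iff hCov hS).2 ⟨T, hT, hTC, hTw⟩⟩, ?_⟩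
    rintro S' ⟨hS', hfix'⟩
    obtain ⟨T', hT', hTC', hTw'⟩ := (isGaussianBarycenterFixedPoint_iff hCov hS').1 hfix'
    exact posDef_transport_family_unique hw hS' hT' hTC' hTw' hS hT hTC hTw
  · obtain ⟨T, hT, hTC, hTw⟩ := (isGaussianBarycenterFixedPoint_iff hCov hCs).1 hfix
    exact sum_mul_kantorovich_gaussianMeasure_le hCov hw hw1 hCs hT hTC hTw
      ((memLp_two_iff_integrable_sq_norm (by fun_prop)).2 hν)
end

section
/- Let μ_1,…,μ_k be histograms on ℝ, where μ_j has L_j + 1 bin edges, and let w_1,…,w_k ≥ 0 with Σ_j w_j = 1. Let ν be the probability measure on ℝ obtained as the pushforward of the uniform (Lebesgue) measure on (0,1) under the map u ↦ Σ_{j=1}^k w_j F_{μ_j}^{-1}(u) (the Wasserstein-2 barycenter of μ_1,…,μ_k with weights w). Then ν is itself a histogram, and its number of bin edges is at most the total number of bin edges across all the input histograms, i.e. at most Σ_{j=1}^k (L_j + 1). -/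
open MeasureTheory ProbabilityTheory

/-- The quantile function `F_μ⁻¹ (u) = inf {x | F_μ x ≥ u}` of a measure on `ℝ`. -/
noncomputable def quantile (μ : Measure ℝ) (u : ℝ) : ℝ :=
  sInf {x : ℝ | u ≤ cdf μ x}

/-- `μ` is a histogram on `ℝ` with `numEdges` bin edges: a probability measure absolutely
continuous w.r.t. Lebesgue, whose density is constant on each open bin determined by the
strictly increasing bin edges and vanishes outside the range of the edges. -/
def IsHistogram (μ : Measure ℝ) (numEdges : ℕ) : Prop :=
  IsProbabilityMeasure μ ∧
  ∃ (L : ℕ) (a : Fin (L + 1) → ℝ) (f : ℝ → ℝ),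
    numEdges = L + 1 ∧ StrictMono a ∧ 0 ≤ f ∧
    μ = volume.withDensity (fun x => ENNReal.ofReal (f x)) ∧
    (∀ i : Fin L, ∃ cst : ℝ, ∀ x ∈ Set.Ioo (a i.castSucc) (a i.succ), f x = cst) ∧
    (∀ x, x ∉ Set.Icc (a 0) (a (Fin.last L)) → f x = 0)

/-- The right-continuous generalized inverse `inf {x | F_μ x > u}` of the distribution function. -/
noncomputable def upperQuantile (μ : Measure ℝ) (u : ℝ) : ℝ :=
  sInf {x : ℝ | u < cdf μ x}

/-- The points `a` cut `ℝ` into intervals on which the distribution function of `μ` is affine, and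
`μ` has no mass outside the range of `a`. -/
structure IsCdfSubdivision (μ : Measure ℝ) {n : ℕ} (a : Fin (n + 1) → ℝ) : Prop where
  strictMono : StrictMono a
  cdf_zero : cdf μ (a 0) = 0
  cdf_last : cdf μ (a (Fin.last n)) = 1
  affine : ∀ i : Fin n, ∃ c : ℝ, ∀ x ∈ Set.Icc (a i.castSucc) (a i.succ),
    cdf μ x = cdf μ (a i.castSucc) + c * (x - a i.castSucc)

lemma IsHistogram.exists_isCdfSubdivision {μ : Measure ℝ} {n : ℕ} (h : IsHistogram μ (n + 1)) :
    ∃ a : Fin (n + 1) → ℝ, IsCdfSubdivision μ a := by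
  obtain ⟨hprob, L, a, f, hL, ha, hf, hμ, hconst, hout⟩ := h
  obtain rfl : n = L := by omega
  have hμs : ∀ {s : Set ℝ}, MeasurableSet s → μ s = ∫⁻ x in s, ENNReal.ofReal (f x) := by
    intro s hs
    rw [hμ, withDensity_apply _ hs]
  refine ⟨a, ha, ?_, ?_, fun i => ?_⟩
  · have hzero : μ (Set.Iic (a 0)) = 0 := by
      rw [hμs measurableSet_Iic, ← setLIntegral_congr Iio_ae_eq_Iic,
        setLIntegral_congr_fun (g := fun _ => 0) measurableSet_Iio, lintegral_zero]
      intro x hx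
      simp [hout x fun hx' => absurd hx'.1 (not_le.2 hx)]
    rw [cdf_eq_real, measureReal_def, hzero, ENNReal.toReal_zero]
  · have hzero : μ (Set.Iic (a (Fin.last n)))ᶜ = 0 := by
      rw [hμs measurableSet_Iic.compl,
        setLIntegral_congr_fun (g := fun _ => 0) measurableSet_Iic.compl, lintegral_zero]
      intro x hx
      simp [hout x fun hx' => hx hx'.2]
    rw [cdf_eq_real, measureReal_def, (prob_compl_eq_zero_iff measurableSet_Iic).1 hzero,
      ENNReal.toReal_one]
  · obtain ⟨c, hc⟩ := hconst i
    refine ⟨c, fun x hx => ?_⟩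
    have hc0 : 0 ≤ c := by
      obtain ⟨y, hy⟩ := exists_between (ha i.castSucc_lt_succ)
      exact hc y hy ▸ hf y
    have hIoc : μ (Set.Ioc (a i.castSucc) x) = ENNReal.ofReal (c * (x - a i.castSucc)) := by
      rw [hμs measurableSet_Ioc, ← setLIntegral_congr Ioo_ae_eq_Ioc,
        setLIntegral_congr_fun (g := fun _ => ENNReal.ofReal c) measurableSet_Ioo,
        setLIntegral_const, Real.volume_Ioo, ENNReal.ofReal_mul hc0]
      intro y hy
      simp [hc y ⟨hy.1, hy.2.trans_le hx.2⟩]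
    rw [cdf_eq_real, cdf_eq_real, ← Set.Iic_union_Ioc_eq_Iic hx.1,
      measureReal_union (Set.Iic_disjoint_Ioc le_rfl) measurableSet_Ioc,
      measureReal_def μ (Set.Ioc _ _), hIoc,
      ENNReal.toReal_ofReal (mul_nonneg hc0 (sub_nonneg.2 hx.1))]

section AffineCdf

variable {μ : Measure ℝ} {p q c u : ℝ}

lemma quantile_eq_of_affine (hF : ∀ x ∈ Set.Icc p q, cdf μ x = cdf μ p + c * (x - p))
    (hc : 0 < c) (hpq : p ≤ q) (hu : u ∈ Set.Ioc (cdf μ p) (cdf μ q)) :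
    quantile μ u = p + (u - cdf μ p) / c := by
  have hq := hF q ⟨hpq, le_rfl⟩
  set y := p + (u - cdf μ p) / c with hy
  have hcy : c * (y - p) = u - cdf μ p := by rw [hy]; field_simp; ring
  have hpy : p < y := by nlinarith [hu.1]
  have hyq : y ≤ q := by nlinarith [hu.2]
  have hset : {x : ℝ | u ≤ cdf μ x} = Set.Ici y := by
    ext x
    refine ⟨fun hx => ?_, fun hx => ?_⟩
    · by_contra hxy
      have hxy' : x < y := not_le.1 hxy
      have hmax := hF (max x p) ⟨le_max_right _ _, (max_lt hxy' hpy).le.trans hyq⟩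
      have hle : u ≤ cdf μ (max x p) := le_trans hx (monotone_cdf μ (le_max_left _ _))
      nlinarith [max_lt hxy' hpy]
    · have hyF := hF y ⟨hpy.le, hyq⟩
      exact le_trans (by linarith) (monotone_cdf μ hx)
  rw [quantile, hset, csInf_Ici]

lemma upperQuantile_eq_of_affine (hF : ∀ x ∈ Set.Icc p q, cdf μ x = cdf μ p + c * (x - p))
    (hc : 0 < c) (hpq : p ≤ q) (hu : u ∈ Set.Ico (cdf μ p) (cdf μ q)) :
    upperQuantile μ u = p + (u - cdf μ p) / c := by
  have hq := hF q ⟨hpq, le_rfl⟩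
  set y := p + (u - cdf μ p) / c with hy
  have hcy : c * (y - p) = u - cdf μ p := by rw [hy]; field_simp; ring
  have hpy : p ≤ y := by nlinarith [hu.1]
  have hyq : y < q := by nlinarith [hu.2]
  have hset : {x : ℝ | u < cdf μ x} = Set.Ioi y := by
    ext x
    refine ⟨fun hx => ?_, fun hx => ?_⟩
    · by_contra hxy
      have hle := monotone_cdf μ (not_lt.1 hxy)
      have hyF := hF y ⟨hpy, hyq.le⟩
      have hx' : u < cdf μ x := hx
      linarith
    · have hlt : y < min x q := lt_min hx hyq
      have hmin := hF (min x q) ⟨hpy.trans hlt.le, min_le_right _ _⟩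
      refine lt_of_lt_of_le ?_ (monotone_cdf μ (min_le_left x q))
      nlinarith
  rw [upperQuantile, hset, csInf_Ioi]

end AffineCdf

lemma Fin.exists_castSucc_and_not_succ {n : ℕ} {P : Fin (n + 1) → Prop} (h0 : P 0)
    (hlast : ¬ P (Fin.last n)) : ∃ i : Fin n, P i.castSucc ∧ ¬ P i.succ := by
  by_contra! h
  exact hlast (Fin.induction h0 h (Fin.last n))

namespace IsCdfSubdivision

variable {μ : Measure ℝ} {n : ℕ} {a : Fin (n + 1) → ℝ}

lemma exists_affine_quantile (h : IsCdfSubdivision μ a) {i : Fin n}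
    (hi : cdf μ (a i.castSucc) < cdf μ (a i.succ)) :
    ∃ c : ℝ, 0 < c ∧
      cdf μ (a i.succ) = cdf μ (a i.castSucc) + c * (a i.succ - a i.castSucc) ∧
      (∀ u ∈ Set.Ioc (cdf μ (a i.castSucc)) (cdf μ (a i.succ)),
        quantile μ u = a i.castSucc + (u - cdf μ (a i.castSucc)) / c) ∧
      ∀ u ∈ Set.Ico (cdf μ (a i.castSucc)) (cdf μ (a i.succ)),
        upperQuantile μ u = a i.castSucc + (u - cdf μ (a i.castSucc)) / c := by
  obtain ⟨c, hF⟩ := h.affine i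
  have hlt := h.strictMono i.castSucc_lt_succ
  have hq := hF _ ⟨hlt.le, le_rfl⟩
  have hc : 0 < c := by
    by_contra! hc
    nlinarith
  exact ⟨c, hc, hq, fun u hu => quantile_eq_of_affine hF hc hlt.le hu,
    fun u hu => upperQuantile_eq_of_affine hF hc hlt.le hu⟩

lemma exists_mem_Ico (h : IsCdfSubdivision μ a) {s : ℝ} (hs : s ∈ Set.Ico (0 : ℝ) 1) :
    ∃ i : Fin n, s ∈ Set.Ico (cdf μ (a i.castSucc)) (cdf μ (a i.succ)) := by
  obtain ⟨i, hi, hi'⟩ := Fin.exists_castSucc_and_not_succ (P := fun i => cdf μ (a i) ≤ s)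
    (by rw [h.cdf_zero]; exact hs.1) (by rw [h.cdf_last]; exact not_le.2 hs.2)
  exact ⟨i, hi, not_le.1 hi'⟩

lemma exists_mem_Ioc (h : IsCdfSubdivision μ a) {s : ℝ} (hs : s ∈ Set.Ioc (0 : ℝ) 1) :
    ∃ i : Fin n, s ∈ Set.Ioc (cdf μ (a i.castSucc)) (cdf μ (a i.succ)) := by
  obtain ⟨i, hi, hi'⟩ := Fin.exists_castSucc_and_not_succ (P := fun i => cdf μ (a i) < s)
    (by rw [h.cdf_zero]; exact hs.1) (by rw [h.cdf_last]; exact not_lt.2 hs.2)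
  exact ⟨i, hi, not_lt.1 hi'⟩

/-- The quantile function can only jump at a level attained at two distinct points of `a`. -/
lemma quantile_eq_upperQuantile (h : IsCdfSubdivision μ a) {s : ℝ} (hs : s ∈ Set.Ioo (0 : ℝ) 1)
    (hinj : ∀ i i', cdf μ (a i) = s → cdf μ (a i') = s → i = i') :
    quantile μ s = upperQuantile μ s := by
  obtain ⟨i, hi⟩ := h.exists_mem_Ioc ⟨hs.1, hs.2.le⟩
  obtain ⟨i', hi'⟩ := h.exists_mem_Ico ⟨hs.1.le, hs.2⟩
  obtain ⟨c, hc, hcq, hQ, hR⟩ := h.exists_affine_quantile (hi.1.trans_le hi.2)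
  obtain ⟨c', hc', hcq', hQ', hR'⟩ := h.exists_affine_quantile (hi'.1.trans_lt hi'.2)
  rcases hi.2.lt_or_eq with hlt | heq
  · rw [hQ s hi, hR s ⟨hi.1.le, hlt⟩]
  rcases hi'.1.lt_or_eq with hlt | heq'
  · rw [hQ' s ⟨hlt, hi'.2.le⟩, hR' s hi']
  rw [hQ s hi, hR' s hi', heq', sub_self, zero_div, add_zero, hinj _ _ heq' heq.symm]
  rw [← heq] at hcq
  rw [hcq]
  field_simp
  ring

/-- Between two consecutive levels the quantile function is affine, with one-sided limits given by
`upperQuantile` and `quantile`. -/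
lemma exists_quantile_eq_affine (h : IsCdfSubdivision μ a) {s t : ℝ} (hs : 0 ≤ s) (hst : s < t)
    (ht : t ≤ 1) (hgap : ∀ i, cdf μ (a i) ≤ s ∨ t ≤ cdf μ (a i)) :
    ∃ α β : ℝ, 0 < β ∧ (∀ u ∈ Set.Ioc s t, quantile μ u = α + β * u) ∧
      upperQuantile μ s = α + β * s := by
  obtain ⟨i, hi⟩ := h.exists_mem_Ico ⟨hs, hst.trans_le ht⟩
  obtain ⟨c, hc, -, hQ, hR⟩ := h.exists_affine_quantile (hi.1.trans_lt hi.2)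
  have hti := (hgap i.succ).resolve_left (not_le.2 hi.2)
  refine ⟨a i.castSucc - cdf μ (a i.castSucc) / c, 1 / c, by positivity, fun u hu => ?_, ?_⟩
  · rw [hQ u ⟨hi.1.trans_lt hu.1, hu.2.trans hti⟩]
    ring
  · rw [hR s hi]
    ring

end IsCdfSubdivision

lemma map_affine_volume_restrict_Ioc {α β : ℝ} (hβ : 0 < β) (s t : ℝ) :
    Measure.map (fun u => α + β * u) (volume.restrict (Set.Ioc s t)) =
      ENNReal.ofReal β⁻¹ • volume.restrict (Set.Ioc (α + β * s) (α + β * t)) := by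
  have hpre : (fun u => α + β * u) ⁻¹' Set.Ioc (α + β * s) (α + β * t) = Set.Ioc s t := by
    ext u
    simp [hβ]
  have hmap : Measure.map (fun u => α + β * u) volume =
      ENNReal.ofReal β⁻¹ • (volume : Measure ℝ) := by
    have hcomp : (fun u => α + β * u) = (fun u => α + u) ∘ (fun u => β * u) := rfl
    rw [hcomp, ← Measure.map_map (by fun_prop) (by fun_prop), Real.map_volume_mul_left hβ.ne',
      Measure.map_smul, map_add_left_eq_self, abs_of_pos (inv_pos.2 hβ)]
  rw [← hpre, ← Measure.restrict_map (by fun_prop) measurableSet_Ioc, hmap, Measure.restrict_smul]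

/-- A finite combination of Lebesgue measures on intervals with endpoints in a finite set `E` is a
histogram with bin edges `E`. -/
lemma isHistogram_sum_smul_restrict_Ioc {ι : Type*} [Fintype ι] {c p q : ι → ℝ} {E : Finset ℝ}
    (hE : E.Nonempty) (hc : ∀ i, 0 ≤ c i) (hp : ∀ i, p i ∈ E) (hq : ∀ i, q i ∈ E)
    {ν : Measure ℝ} [IsProbabilityMeasure ν]
    (hν : ν = Measure.sum fun i => ENNReal.ofReal (c i) • volume.restrict (Set.Ioc (p i) (q i))) :
    IsHistogram ν E.card := by
  classical
  obtain ⟨n, hn⟩ : ∃ n, E.card = n + 1 := Nat.exists_eq_succ_of_ne_zero hE.card_pos.ne'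
  have hrange : ∀ {x}, x ∈ E → ∃ i, E.orderEmbOfFin hn i = x := fun {x} hx => by
    have := E.range_orderEmbOfFin hn
    exact this.symm.subset hx
  refine ⟨inferInstance, n, E.orderEmbOfFin hn,
    fun x => ∑ i, (Set.Ioc (p i) (q i)).indicator (fun _ => c i) x, hn,
    (E.orderEmbOfFin hn).strictMono,
    fun x => Finset.sum_nonneg fun i _ => Set.indicator_nonneg (fun _ _ => hc i) x, ?_, ?_, ?_⟩
  · rw [hν]
    ext A hA
    rw [withDensity_apply _ hA, Measure.sum_apply _ hA, tsum_fintype]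
    have hsum : ∀ x, ENNReal.ofReal (∑ i, (Set.Ioc (p i) (q i)).indicator (fun _ => c i) x) =
        ∑ i, (Set.Ioc (p i) (q i)).indicator (fun _ => ENNReal.ofReal (c i)) x := by
      intro x
      rw [ENNReal.ofReal_sum_of_nonneg fun i _ => Set.indicator_nonneg (fun _ _ => hc i) x]
      refine Finset.sum_congr rfl fun i _ => ?_
      by_cases hx : x ∈ Set.Ioc (p i) (q i) <;> simp [hx]
    simp_rw [hsum]
    rw [lintegral_finsetSum _ fun i _ => measurable_const.indicator measurableSet_Ioc]
    refine Finset.sum_congr rfl fun i _ => ?_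
    rw [lintegral_indicator_const measurableSet_Ioc, Measure.smul_apply, smul_eq_mul,
      Measure.restrict_apply hA, Measure.restrict_apply measurableSet_Ioc, Set.inter_comm]
  · intro i
    have hgap : ∀ {x}, x ∈ E → x ≤ E.orderEmbOfFin hn i.castSucc ∨
        E.orderEmbOfFin hn i.succ ≤ x := fun {x} hx => by
      obtain ⟨j, rfl⟩ := hrange hx
      simp only [OrderEmbedding.le_iff_le]
      exact (le_or_gt j i.castSucc).imp id Fin.castSucc_lt_iff_succ_le.1
    obtain ⟨y, hy⟩ := exists_between
      ((E.orderEmbOfFin hn).strictMono i.castSucc_lt_succ)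
    refine ⟨_, fun x hx => (Finset.sum_congr rfl fun j _ => ?_ :
      _ = ∑ j, (Set.Ioc (p j) (q j)).indicator (fun _ => c j) y)⟩
    have hiff : x ∈ Set.Ioc (p j) (q j) ↔ y ∈ Set.Ioc (p j) (q j) := by
      have h1 := hgap (hp j)
      have h2 := hgap (hq j)
      simp only [Set.mem_Ioc, Set.mem_Ioo] at *
      grind
    by_cases hxj : x ∈ Set.Ioc (p j) (q j)
    · simp [hxj, hiff.1 hxj]
    · simp [hxj, mt hiff.2 hxj]
  · intro x hx
    refine Finset.sum_eq_zero fun j _ => Set.indicator_of_notMem (fun hxj => hx ⟨?_, ?_⟩) _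
    · obtain ⟨i, hi⟩ := hrange (hp j)
      exact ((E.orderEmbOfFin hn).monotone (Fin.zero_le i)).trans (hi.le.trans hxj.1.le)
    · obtain ⟨i, hi⟩ := hrange (hq j)
      exact (hxj.2.trans hi.ge).trans ((E.orderEmbOfFin hn).monotone (Fin.le_last i))

/-- The pairs of consecutive elements of a finite set of reals. -/
def ConsecutivePair (K : Finset ℝ) : Type :=
  {x : ↥K × ↥K // x.1.1 < x.2.1 ∧ ∀ v ∈ K, v ≤ x.1.1 ∨ x.2.1 ≤ v}

noncomputable instance (K : Finset ℝ) : Fintype (ConsecutivePair K) := by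
  classical
  exact inferInstanceAs (Fintype {x : ↥K × ↥K // x.1.1 < x.2.1 ∧ ∀ v ∈ K, v ≤ x.1.1 ∨ x.2.1 ≤ v})

/-- A finite set of points cuts the interval between two of them. -/
lemma iUnion_Ioc_consecutivePair {K : Finset ℝ} {b d : ℝ} (hb : b ∈ K) (hd : d ∈ K)
    (hK : ∀ v ∈ K, v ∈ Set.Icc b d) :
    ⋃ x : ConsecutivePair K, Set.Ioc x.1.1.1 x.1.2.1 = Set.Ioc b d := by
  classical
  ext u
  simp only [Set.mem_iUnion]
  refine ⟨fun ⟨x, hx⟩ => ⟨(hK _ x.1.1.2).1.trans_lt hx.1, hx.2.trans (hK _ x.1.2.2).2⟩,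
    fun hu => ?_⟩
  have hlo : (K.filter (· < u)).Nonempty := ⟨b, by simp [hb, hu.1]⟩
  have hhi : (K.filter (u ≤ ·)).Nonempty := ⟨d, by simp [hd, hu.2]⟩
  obtain ⟨s, hs, hsmax⟩ := (K.filter (· < u)).exists_max_image id hlo
  obtain ⟨t, ht, htmin⟩ := (K.filter (u ≤ ·)).exists_min_image id hhi
  simp only [Finset.mem_filter, id] at hs ht hsmax htmin
  refine ⟨⟨(⟨s, hs.1⟩, ⟨t, ht.1⟩), hs.2.trans_le ht.2, fun v hv => ?_⟩, hs.2, ht.2⟩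
  exact (lt_or_ge v u).imp (fun h => hsmax v ⟨hv, h⟩) (fun h => htmin v ⟨hv, h⟩)

lemma pairwise_disjoint_Ioc_consecutivePair (K : Finset ℝ) :
    Pairwise (Function.onFun Disjoint
      fun x : ConsecutivePair K => Set.Ioc x.1.1.1 x.1.2.1) := by
  intro x y hxy
  refine Set.disjoint_left.2 fun u hux huy => hxy ?_
  have h1 := x.2.2 _ y.1.1.2
  have h2 := x.2.2 _ y.1.2.2
  have h3 := y.2.2 _ x.1.1.2
  have h4 := y.2.2 _ x.1.2.2
  simp only [Set.mem_Ioc] at hux huy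
  exact Subtype.ext (Prod.ext (Subtype.ext (by grind)) (Subtype.ext (by grind)))

/-- If `Q` is affine and increasing between consecutive points of `K`, it pushes the Lebesgue
measure on `(0, 1)` to a histogram whose edges are the one-sided limits of `Q` on `K`. -/
lemma isHistogram_map_of_piecewise_affine {Q R : ℝ → ℝ} {K E : Finset ℝ} (h0 : 0 ∈ K)
    (h1 : 1 ∈ K) (hK : ∀ v ∈ K, v ∈ Set.Icc (0 : ℝ) 1)
    (hQ : ∀ s t, 0 ≤ s → s < t → t ≤ 1 → (∀ v ∈ K, v ≤ s ∨ t ≤ v) →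
      ∃ α β : ℝ, 0 < β ∧ (∀ u ∈ Set.Ioc s t, Q u = α + β * u) ∧ R s = α + β * s)
    (hQE : ∀ t ∈ K, 0 < t → Q t ∈ E) (hRE : ∀ s ∈ K, s < 1 → R s ∈ E) :
    IsHistogram (Measure.map Q (volume.restrict (Set.Ioo (0 : ℝ) 1))) E.card := by
  have hI : ∀ x : ConsecutivePair K, ∃ α β : ℝ, 0 < β ∧
      (∀ u ∈ Set.Ioc x.1.1.1 x.1.2.1, Q u = α + β * u) ∧ R x.1.1.1 = α + β * x.1.1.1 :=
    fun x => hQ _ _ (hK _ x.1.1.2).1 x.2.1 (hK _ x.1.2.2).2 x.2.2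
  choose α β hβ hQα hRα using hI
  have heq : ∀ x : ConsecutivePair K, (fun u => α x + β x * u) =ᵐ[volume.restrict
      (Set.Ioc x.1.1.1 x.1.2.1)] Q := fun x =>
    (ae_restrict_iff' measurableSet_Ioc).2 (.of_forall fun u hu => (hQα x u hu).symm)
  have hQmeas : AEMeasurable Q (volume.restrict (Set.Ioo (0 : ℝ) 1)) := by
    rw [Measure.restrict_congr_set Ioo_ae_eq_Ioc, ← iUnion_Ioc_consecutivePair h0 h1 hK,
      aemeasurable_iUnion_iff]
    exact fun x => ⟨_, by fun_prop, (heq x).symm⟩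
  have : IsProbabilityMeasure (volume.restrict (Set.Ioo (0 : ℝ) 1)) := ⟨by simp⟩
  have := Measure.isProbabilityMeasure_map hQmeas
  refine isHistogram_sum_smul_restrict_Ioc ⟨_, hQE 1 h1 one_pos⟩
    (c := fun x : ConsecutivePair K => (β x)⁻¹) (p := fun x => R x.1.1.1) (q := fun x => Q x.1.2.1)
    (fun x => (inv_pos.2 (hβ x)).le)
    (fun x => hRE _ x.1.1.2 (x.2.1.trans_le (hK _ x.1.2.2).2))
    (fun x => hQE _ x.1.2.2 ((hK _ x.1.1.2).1.trans_lt x.2.1)) ?_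
  rw [Measure.restrict_congr_set Ioo_ae_eq_Ioc, ← iUnion_Ioc_consecutivePair h0 h1 hK] at hQmeas ⊢
  rw [Measure.restrict_iUnion (pairwise_disjoint_Ioc_consecutivePair K)
    fun _ => measurableSet_Ioc] at hQmeas ⊢
  rw [Measure.map_sum hQmeas]
  congr 1
  funext x
  rw [← Measure.map_congr (heq x), map_affine_volume_restrict_Ioc (hβ x), hRα x,
    hQα x _ ⟨x.2.1, le_rfl⟩]

/-- The Wasserstein-2 barycenter of histograms `μ 1, …, μ k` (with
`L j + 1` bin edges each) with weights `w`, i.e. the pushforward of the uniform measure on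
`(0,1)` under `u ↦ ∑ j, w j * quantile (μ j) u`, is itself a histogram whose number of bin
edges is at most `∑ j, (L j + 1)`. -/
theorem barycenter_of_histograms_is_histogram
    (k : ℕ) (μ : Fin k → Measure ℝ) (L : Fin k → ℕ)
    (hμ : ∀ j, IsHistogram (μ j) (L j + 1))
    (w : Fin k → ℝ) (hw : ∀ j, 0 ≤ w j) (hw1 : ∑ j, w j = 1)
    (ν : Measure ℝ)
    (hν : ν = Measure.map (fun u => ∑ j, w j * quantile (μ j) u)
      (volume.restrict (Set.Ioo (0 : ℝ) 1))) :
    ∃ numEdges : ℕ, IsHistogram ν numEdges ∧ numEdges ≤ ∑ j, (L j + 1) := by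
  classical
  choose a ha using fun j => (hμ j).exists_isCdfSubdivision
  set Q : ℝ → ℝ := fun u => ∑ j, w j * quantile (μ j) u with hQdef
  set R : ℝ → ℝ := fun u => ∑ j, w j * upperQuantile (μ j) u with hRdef
  let level : (Σ j, Fin (L j + 1)) → ℝ := fun x => cdf (μ x.1) (a x.1 x.2)
  let edge : (Σ j, Fin (L j + 1)) → ℝ := fun x =>
    if 0 < level x ∧ ∀ i < x.2, level ⟨x.1, i⟩ ≠ level x then Q (level x) else R (level x)
  obtain ⟨j₀⟩ : Nonempty (Fin k) := by
    by_contra hk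
    rw [not_nonempty_iff] at hk
    simp at hw1
  have hQE : ∀ x, 0 < level x → Q (level x) ∈ Finset.univ.image edge := by
    rintro ⟨j, i⟩ hpos
    obtain ⟨m, hm, hmin⟩ := (Finset.univ.filter fun i' =>
      level ⟨j, i'⟩ = level ⟨j, i⟩).exists_min_image id ⟨i, by simp⟩
    simp only [Finset.mem_filter, Finset.mem_univ, true_and, id] at hm hmin
    refine Finset.mem_image.2 ⟨⟨j, m⟩, Finset.mem_univ _, ?_⟩
    rw [← hm]
    exact if_pos ⟨hm ▸ hpos, fun i' hi' heq => (hmin i' (heq.trans hm)).not_gt hi'⟩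
  have hRE : ∀ x, level x < 1 → R (level x) ∈ Finset.univ.image edge := by
    intro x hlt
    rcases (cdf_nonneg (μ x.1) (a x.1 x.2)).eq_or_lt with h0 | hpos
    · refine Finset.mem_image.2 ⟨x, Finset.mem_univ _, if_neg fun h => h.1.ne h0⟩
    by_cases hdup : ∃ j, ∃ i i' : Fin (L j + 1), i < i' ∧ level ⟨j, i⟩ = level x ∧
        level ⟨j, i'⟩ = level x
    · obtain ⟨j, i, i', hii', hi, hi'⟩ := hdup
      refine Finset.mem_image.2 ⟨⟨j, i'⟩, Finset.mem_univ _, ?_⟩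
      rw [← hi']
      exact if_neg fun h => h.2 i hii' (hi.trans hi'.symm)
    · have hQR : Q (level x) = R (level x) := by
        refine Finset.sum_congr rfl fun j _ => ?_
        rw [(ha j).quantile_eq_upperQuantile ⟨hpos, hlt⟩ fun i i' hi hi' => ?_]
        by_contra hne
        rcases lt_or_gt_of_ne hne with h | h
        · exact hdup ⟨j, i, i', h, hi, hi'⟩
        · exact hdup ⟨j, i', i, h, hi', hi⟩
      exact hQR ▸ hQE x hpos
  refine ⟨(Finset.univ.image edge).card, ?_, ?_⟩
  · rw [hν]
    refine isHistogram_map_of_piecewise_affine (R := R) (K := Finset.univ.image level)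
      (Finset.mem_image.2 ⟨⟨j₀, 0⟩, Finset.mem_univ _, (ha j₀).cdf_zero⟩)
      (Finset.mem_image.2 ⟨⟨j₀, Fin.last _⟩, Finset.mem_univ _, (ha j₀).cdf_last⟩) ?_ ?_ ?_ ?_
    · simp only [Finset.forall_mem_image]
      exact fun x _ => ⟨cdf_nonneg _ _, cdf_le_one _ _⟩
    · intro s t hs hst ht hgap
      have hj : ∀ j, ∃ α β : ℝ, 0 < β ∧ (∀ u ∈ Set.Ioc s t, quantile (μ j) u = α + β * u) ∧
          upperQuantile (μ j) s = α + β * s := fun j =>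
        (ha j).exists_quantile_eq_affine hs hst ht fun i =>
          hgap _ (Finset.mem_image_of_mem level (Finset.mem_univ ⟨j, i⟩))
      choose α β hβ hQα hRα using hj
      refine ⟨∑ j, w j * α j, ∑ j, w j * β j, ?_, fun u hu => ?_, ?_⟩
      · obtain ⟨j, -, hjpos⟩ := Finset.exists_lt_of_sum_lt (s := Finset.univ) (f := fun _ => 0)
          (g := w) (by simp [hw1])
        exact Finset.sum_pos' (fun j _ => mul_nonneg (hw j) (hβ j).le)
          ⟨j, Finset.mem_univ _, mul_pos hjpos (hβ j)⟩
      · simp only [hQdef, Finset.sum_mul, ← Finset.sum_add_distrib]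
        exact Finset.sum_congr rfl fun j _ => by rw [hQα j u hu]; ring
      · simp only [hRdef, Finset.sum_mul, ← Finset.sum_add_distrib]
        exact Finset.sum_congr rfl fun j _ => by rw [hRα j]; ring
    · simpa only [Finset.forall_mem_image] using fun x _ => hQE x
    · simpa only [Finset.forall_mem_image] using fun x _ => hRE x
  · refine Finset.card_image_le.trans ?_
    simp
end
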